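/- arXiv:2509.03996 — 5 statements merged into one kernel-verified Lean document; each statement's English description precedes it below -/
import Mathlib

section
/- Let x : ℝ → ℝ be differentiable with x′(t) = 3x(t) − x(t)³ + 2 for all t, and suppose −1 < x(0) < 2. Then x(t) → −1 as t → −∞ and x(t) → 2 as t → +∞; moreover x is strictly increasing and −1 < x(t) < 2 for all t. -/
open Filter

/-- A solution of a scalar linear homogeneous equation `y′ = g y` that is positive at `0` stays
positive. -/
theorem pos_of_hasDerivAt_mul {y g : ℝ → ℝ} (hg : Continuous g)
    (hy : ∀ t, HasDerivAt y (g t * y t) t) (h0 : 0 < y 0) (t : ℝ) : 0 < y t := by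
  have hG : ∀ t, HasDerivAt (fun t => ∫ s in (0 : ℝ)..t, g s) (g t) t := fun t =>
    (hg.integral_hasStrictDerivAt 0 t).hasDerivAt
  have hz : ∀ t, HasDerivAt (fun t => y t * Real.exp (-∫ s in (0 : ℝ)..t, g s)) 0 t := fun t => by
    refine ((hy t).mul (hG t).neg.exp).congr_deriv ?_
    ring
  have hc := is_const_of_deriv_eq_zero (fun t => (hz t).differentiableAt)
    (fun t => (hz t).deriv) t 0
  simp only [intervalIntegral.integral_same, neg_zero, Real.exp_zero, mul_one] at hc
  exact pos_of_mul_pos_left (hc ▸ h0) (Real.exp_pos _).le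

/-- The limit at `+∞` of a convergent solution of an autonomous equation is an equilibrium. -/
theorem eq_zero_of_hasDerivAt_of_tendsto_atTop {x f : ℝ → ℝ} {L : ℝ} (hf : ContinuousAt f L)
    (hx : ∀ t, HasDerivAt x (f (x t)) t) (hL : Tendsto x atTop (nhds L)) : f L = 0 := by
  have hmvt : ∀ t : ℝ, ∃ ξ, t < ξ ∧ f (x ξ) = x (t + 1) - x t := fun t => by
    obtain ⟨ξ, hξ, h⟩ := exists_hasDerivAt_eq_slope x (fun s => f (x s)) (lt_add_one t)
      (fun s _ => (hx s).continuousAt.continuousWithinAt) (fun s _ => hx s)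
    exact ⟨ξ, hξ.1, by simpa using h⟩
  choose ξ hξ hfξ using hmvt
  have hξt : Tendsto ξ atTop atTop := tendsto_atTop_mono (fun t => (hξ t).le) tendsto_id
  have hlim : Tendsto (fun t => f (x (ξ t))) atTop (nhds (f L)) :=
    hf.tendsto.comp (hL.comp hξt)
  have hdiff : Tendsto (fun t => f (x (ξ t))) atTop (nhds (L - L)) := by
    simp only [hfξ]
    exact (hL.comp (tendsto_atTop_add_const_right _ 1 tendsto_id)).sub hL
  exact (tendsto_nhds_unique hlim hdiff).trans (sub_self L)

/-- The limit at `-∞` of a convergent solution of an autonomous equation is an equilibrium. -/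
theorem eq_zero_of_hasDerivAt_of_tendsto_atBot {x f : ℝ → ℝ} {L : ℝ} (hf : ContinuousAt f L)
    (hx : ∀ t, HasDerivAt x (f (x t)) t) (hL : Tendsto x atBot (nhds L)) : f L = 0 := by
  refine neg_eq_zero.mp (eq_zero_of_hasDerivAt_of_tendsto_atTop (x := fun t => x (-t))
    (f := fun s => -f s) hf.neg (fun t => ?_) (hL.comp tendsto_neg_atTop_atBot))
  exact ((hx (-t)).comp t (hasDerivAt_neg t)).congr_deriv (by ring)

/-- The frozen tipping trajectory at `λ = 2`: if `x` is differentiable with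
`x′ = 3x − x³ + 2` and `−1 < x(0) < 2`, then `x(t) → −1` as `t → −∞`,
`x(t) → 2` as `t → +∞`, `x` is strictly increasing, and `−1 < x(t) < 2` for all `t`. -/
theorem stmt_7 (x : ℝ → ℝ) (hx : Differentiable ℝ x)
    (hode : ∀ t : ℝ, deriv x t = 3 * x t - (x t) ^ 3 + 2)
    (h0 : -1 < x 0) (h0' : x 0 < 2) :
    Tendsto x atBot (nhds (-1)) ∧
    Tendsto x atTop (nhds 2) ∧
    StrictMono x ∧
    ∀ t : ℝ, -1 < x t ∧ x t < 2 := by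
  have hd : ∀ t, HasDerivAt x (3 * x t - (x t) ^ 3 + 2) t := fun t => hode t ▸ (hx t).hasDerivAt
  have hc : Continuous x := hx.continuous
  have hlo : ∀ t, -1 < x t := fun t => by
    have := pos_of_hasDerivAt_mul (y := fun t => x t + 1) (g := fun t => (x t + 1) * (2 - x t))
      (by fun_prop) (fun t => ((hd t).add_const 1).congr_deriv (by ring)) (by linarith) t
    linarith
  have hhi : ∀ t, x t < 2 := fun t => by
    have := pos_of_hasDerivAt_mul (y := fun t => 2 - x t) (g := fun t => -(x t + 1) ^ 2)
      (by fun_prop) (fun t => ((hd t).const_sub 2).congr_deriv (by ring)) (by linarith) t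
    linarith
  have hmono : StrictMono x := strictMono_of_deriv_pos fun t => by
    have : 0 < (x t + 1) ^ 2 * (2 - x t) :=
      mul_pos (pow_pos (by linarith [hlo t]) 2) (by linarith [hhi t])
    rw [hode]
    linarith
  have hroot : ∀ L : ℝ, 3 * L - L ^ 3 + 2 = 0 → L = -1 ∨ L = 2 := fun L h => by
    have : (L + 1) ^ 2 * (L - 2) = 0 := by linarith
    rcases mul_eq_zero.mp this with h | h
    · exact .inl (by linarith [pow_eq_zero_iff two_ne_zero |>.mp h])
    · exact .inr (by linarith)
  have hbot := tendsto_atBot_ciInf hmono.monotone ⟨-1, by rintro _ ⟨t, rfl⟩; exact (hlo t).le⟩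
  have htop := tendsto_atTop_ciSup hmono.monotone ⟨2, by rintro _ ⟨t, rfl⟩; exact (hhi t).le⟩
  have hf : Continuous fun s : ℝ => 3 * s - s ^ 3 + 2 := by fun_prop
  refine ⟨?_, ?_, hmono, fun t => ⟨hlo t, hhi t⟩⟩
  · rcases hroot _ (eq_zero_of_hasDerivAt_of_tendsto_atBot (f := fun s => 3 * s - s ^ 3 + 2)
      hf.continuousAt hd hbot) with h | h
    · rwa [h] at hbot
    · exact absurd (hmono.monotone.le_of_tendsto hbot 0) (by rw [h]; exact h0'.not_ge)
  · rcases hroot _ (eq_zero_of_hasDerivAt_of_tendsto_atTop (f := fun s => 3 * s - s ^ 3 + 2)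
      hf.continuousAt hd htop) with h | h
    · exact absurd (hmono.monotone.ge_of_tendsto htop 0) (by rw [h]; exact h0.not_ge)
    · rwa [h] at htop
end

section
/- Let λ₋ < λ₊ with λ₋ < 2, let r > 0, define Λ(s) = λ₋ + (λ₊ − λ₋)(tanh(s) + 1)/2, and let X_l(λ₋) denote the unique real root of 3x − x³ + λ₋ = 0 with x < −1. Then there exists exactly one differentiable function x : ℝ → ℝ satisfying x′(t) = 3x(t) − x(t)³ + Λ(rt) for all t ∈ ℝ and x(t) → X_l(λ₋) as t → −∞. -/
open Filter

section ScalarODE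

open Set MeasureTheory
open scoped NNReal Topology

lemma nonpos_of_deriv_right_le_mul {d d' : ℝ → ℝ} {a b K : ℝ} (hd : ContinuousOn d (Icc a b))
    (hd' : ∀ t ∈ Ico a b, HasDerivWithinAt d (d' t) (Ici t) t) (ha : d a ≤ 0)
    (bound : ∀ t ∈ Ico a b, 0 < d t → d' t ≤ K * d t) : ∀ t ∈ Icc a b, d t ≤ 0 := by
  intro t ht
  have key : ∀ ε > 0, d t ≤ ε * Real.exp ((K + 1) * (t - a)) := by
    intro ε hε
    have hB : ∀ s, HasDerivAt (fun s => ε * Real.exp ((K + 1) * (s - a)))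
        (ε * (Real.exp ((K + 1) * (s - a)) * (K + 1))) s := fun s => by
      have h := ((((hasDerivAt_id s).sub_const a).const_mul (K + 1)).exp).const_mul ε
      simpa using h
    refine image_le_of_deriv_right_lt_deriv_boundary hd hd' ?_ hB ?_ ht
    · simpa using ha.trans hε.le
    · intro s hs h
      have hpos : 0 < d s := by rw [h]; positivity
      have := bound s hs hpos
      rw [h] at this hpos
      linarith
  refine ge_of_tendsto (x := 𝓝[>] 0) (f := fun ε : ℝ => ε * Real.exp ((K + 1) * (t - a))) ?_ ?_
  · have h : Tendsto (fun ε : ℝ => ε * Real.exp ((K + 1) * (t - a))) (𝓝 0)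
        (𝓝 (0 * Real.exp ((K + 1) * (t - a)))) := tendsto_id.mul_const _
    rw [zero_mul] at h
    exact h.mono_left nhdsWithin_le_nhds
  · filter_upwards [self_mem_nhdsWithin] with ε hε using key ε hε

/-- Comparison of a subsolution and a supersolution of `x′ = φ(x) + g(t)` for a one-sided
Lipschitz `φ`. -/
lemma le_of_subsolution_of_supersolution {φ g u v u' v' : ℝ → ℝ} {a b K : ℝ}
    (hφ : ∀ x y, x ≤ y → φ y - φ x ≤ K * (y - x))
    (hu : ∀ t ∈ Icc a b, HasDerivWithinAt u (u' t) (Icc a b) t)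
    (hv : ∀ t ∈ Icc a b, HasDerivWithinAt v (v' t) (Icc a b) t)
    (hsub : ∀ t ∈ Icc a b, u' t ≤ φ (u t) + g t)
    (hsuper : ∀ t ∈ Icc a b, φ (v t) + g t ≤ v' t)
    (ha : u a ≤ v a) : ∀ t ∈ Icc a b, u t ≤ v t := by
  intro t ht
  have hd : ∀ t ∈ Icc a b, HasDerivWithinAt (fun t => u t - v t) (u' t - v' t) (Icc a b) t :=
    fun t ht => (hu t ht).sub (hv t ht)
  have := nonpos_of_deriv_right_le_mul (K := K) (fun t ht => (hd t ht).continuousWithinAt)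
    (fun t ht => (hd t (Ico_subset_Icc_self ht)).mono_of_mem_nhdsWithin
      (mem_of_superset (Icc_mem_nhdsGE ht.2) (Icc_subset_Icc_left ht.1)))
    (by linarith) (fun t ht hpos => ?_) t ht
  · linarith
  · have h := Ico_subset_Icc_self ht
    have := hφ (v t) (u t) (by linarith)
    linarith [hsub t h, hsuper t h]

lemma exists_solution_Icc {φ g : ℝ → ℝ} {K L : ℝ≥0} (hφ : LipschitzWith K φ) (hg : Continuous g)
    (hL : ∀ x t, |φ x + g t| ≤ L) {a b : ℝ} (hab : a ≤ b) (x₀ : ℝ) :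
    ∃ u : ℝ → ℝ, u a = x₀ ∧ ∀ t ∈ Icc a b, HasDerivWithinAt u (φ (u t) + g t) (Icc a b) t := by
  have hpl : IsPicardLindelof (fun t x => φ x + g t) (tmin := a) (tmax := b)
      ⟨a, left_mem_Icc.2 hab⟩ x₀ (L * (b - a).toNNReal) 0 L K :=
    { lipschitzOnWith := fun t _ => LipschitzWith.lipschitzOnWith <| by
        refine LipschitzWith.of_dist_le_mul fun x y => ?_
        simpa using hφ.dist_le_mul x y
      continuousOn := fun x _ => (continuous_const.add hg).continuousOn
      norm_le := fun t _ x _ => hL x t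
      mul_max_le := by simp [hab] }
  exact hpl.exists_eq_forall_mem_Icc_hasDerivWithinAt₀

/-- If a constant `X` is a subsolution and `M ≥ X` a supersolution of `x′ = φ(x) + g(t)`, some
complete solution stays between them, and stays below every constant `y ≥ X` which is a
supersolution in the past. -/
lemma exists_complete_solution {φ g : ℝ → ℝ} {K L : ℝ≥0} (hφ : LipschitzWith K φ)
    (hg : Continuous g) (hL : ∀ x t, |φ x + g t| ≤ L) {X M : ℝ} (hXM : X ≤ M)
    (hX : ∀ t, 0 ≤ φ X + g t) (hM : ∀ t, φ M + g t ≤ 0) :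
    ∃ x : ℝ → ℝ, (∀ t, HasDerivAt x (φ (x t) + g t) t) ∧ (∀ t, X ≤ x t) ∧ (∀ t, x t ≤ M) ∧
      ∀ y T, X ≤ y → (∀ t ≤ T, φ y + g t ≤ 0) → ∀ t ≤ T, x t ≤ y := by
  have hφ' : ∀ x y, x ≤ y → φ y - φ x ≤ K * (y - x) := fun x y h => by
    have := hφ.dist_le_mul y x
    rw [Real.dist_eq, Real.dist_eq, abs_of_nonneg (sub_nonneg.2 h)] at this
    exact (le_abs_self _).trans this
  choose u hu0 hu using fun n : ℕ =>
    exists_solution_Icc hφ hg hL (neg_le_self (Nat.cast_nonneg (α := ℝ) n)) X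
  have huc : ∀ n, ContinuousOn (u n) (Icc (-n) n) := fun n t ht => (hu n t ht).continuousWithinAt
  have hlow : ∀ n : ℕ, ∀ t ∈ Icc (-n : ℝ) n, X ≤ u n t := fun n =>
    le_of_subsolution_of_supersolution (u := fun _ => X) (u' := fun _ => 0) hφ'
      (fun t _ => hasDerivWithinAt_const _ _ _) (hu n) (fun t _ => hX t) (fun t _ => le_rfl)
      (hu0 n).ge
  have hupp : ∀ y T, X ≤ y → (∀ t ≤ T, φ y + g t ≤ 0) →
      ∀ n : ℕ, ∀ t ≤ T, t ∈ Icc (-n : ℝ) n → u n t ≤ y := by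
    intro y T hy hT n t htT ht
    have hsub : Icc (-n : ℝ) t ⊆ Icc (-n) n := Icc_subset_Icc_right ht.2
    exact le_of_subsolution_of_supersolution (v := fun _ => y) (v' := fun _ => 0) hφ'
      (fun s hs => (hu n s (hsub hs)).mono hsub)
      (fun s _ => hasDerivWithinAt_const _ _ _) (fun s _ => le_rfl)
      (fun s hs => hT s (hs.2.trans htT)) ((hu0 n).le.trans hy) t (right_mem_Icc.2 ht.1)
  have hmono : ∀ n : ℕ, ∀ t ∈ Icc (-n : ℝ) n, u n t ≤ u (n + 1) t := by
    intro n
    have hsub : Icc (-n : ℝ) n ⊆ Icc (-(n + 1 : ℕ)) (n + 1 : ℕ) :=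
      Icc_subset_Icc (by push_cast; linarith) (by push_cast; linarith)
    refine le_of_subsolution_of_supersolution hφ' (hu n)
      (fun s hs => (hu (n + 1) s (hsub hs)).mono hsub) (fun _ _ => le_rfl) (fun _ _ => le_rfl) ?_
    rw [hu0 n]
    exact hlow (n + 1) _ (hsub (left_mem_Icc.2 (neg_le_self n.cast_nonneg)))
  have hmem : ∀ (t : ℝ), ∃ N : ℕ, ∀ n, N ≤ n → t ∈ Icc (-n : ℝ) n := fun t => by
    obtain ⟨N, hN⟩ := exists_nat_ge |t|
    exact ⟨N, fun n hn => abs_le.1 (hN.trans (by exact_mod_cast hn))⟩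
  have hconv : ∀ t, ∃ l, Tendsto (fun n => u n t) atTop (𝓝 l) := fun t => by
    obtain ⟨N, hN⟩ := hmem t
    refine ⟨_, (tendsto_add_atTop_iff_nat N).1 (tendsto_atTop_ciSup
      (monotone_nat_of_le_succ fun n => ?_) ⟨M, ?_⟩)⟩
    · rw [Nat.add_right_comm]
      exact hmono _ t (hN _ (by omega))
    · rintro _ ⟨n, rfl⟩
      exact hupp M t hXM (fun s _ => hM s) _ t le_rfl (hN _ (by omega))
  choose x hx using hconv
  have hev : ∀ t, ∀ᶠ n : ℕ in atTop, t ∈ Icc (-n : ℝ) n := fun t =>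
    let ⟨N, hN⟩ := hmem t
    eventually_atTop.2 ⟨N, hN⟩
  have hlip : LipschitzWith L x := by
    refine LipschitzWith.of_dist_le_mul fun s t => ?_
    refine le_of_tendsto ((hx s).dist (hx t)) ?_
    filter_upwards [hev s, hev t] with n hs ht
    exact ((convex_Icc _ _).lipschitzOnWith_of_nnnorm_hasDerivWithin_le (hu n)
      (fun r _ => hL _ r)).dist_le_mul s hs t ht
  have hcont : Continuous fun t => φ (x t) + g t := (hφ.continuous.comp hlip.continuous).add hg
  have hint : ∀ t, x t = x 0 + ∫ s in (0:ℝ)..t, (φ (x s) + g s) := by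
    intro t
    have hsub : ∀ᶠ n : ℕ in atTop, uIcc 0 t ⊆ Icc (-n : ℝ) n := by
      filter_upwards [hev 0, hev t] with n h0 ht using ordConnected_Icc.uIcc_subset h0 ht
    have huc' : ∀ n : ℕ, uIcc 0 t ⊆ Icc (-n : ℝ) n →
        ContinuousOn (fun s => φ (u n s) + g s) (uIcc 0 t) := fun n h =>
      (hφ.continuous.comp_continuousOn ((huc n).mono h)).add hg.continuousOn
    have hlim : Tendsto (fun n => ∫ s in (0:ℝ)..t, (φ (u n s) + g s)) atTop
        (𝓝 (∫ s in (0:ℝ)..t, (φ (x s) + g s))) := by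
      refine intervalIntegral.tendsto_integral_filter_of_dominated_convergence (fun _ => L)
        ?_ ?_ intervalIntegrable_const ?_
      · filter_upwards [hsub] with n hn
        exact ((huc' n hn).mono uIoc_subset_uIcc).aestronglyMeasurable measurableSet_uIoc
      · exact Eventually.of_forall fun n => Eventually.of_forall fun s _ => hL _ _
      · exact Eventually.of_forall fun s _ =>
          ((hφ.continuous.tendsto _).comp (hx s)).add_const _
    have heq : ∀ᶠ n in atTop, ∫ s in (0:ℝ)..t, (φ (u n s) + g s) = u n t - u n 0 := by
      filter_upwards [hsub] with n hn
      refine intervalIntegral.integral_eq_sub_of_hasDeriv_right ((huc n).mono hn)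
        (fun s hs => ?_) (huc' n hn).intervalIntegrable
      have hs' : s ∈ uIcc 0 t := Ioo_subset_Icc_self hs
      exact (((hu n s (hn hs')).mono hn).hasDerivAt (Icc_mem_nhds hs.1 hs.2)).hasDerivWithinAt
    have := tendsto_nhds_unique (hlim.congr' heq) ((hx t).sub (hx 0))
    linarith
  refine ⟨x, fun t => ?_, fun t => ?_, fun t => ?_, fun y T hy hT t ht => ?_⟩
  · have h := (intervalIntegral.integral_hasDerivAt_right (hcont.intervalIntegrable 0 t)
      (hcont.stronglyMeasurableAtFilter _ _) hcont.continuousAt).const_add (x 0)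
    exact h.congr_of_eventuallyEq (Eventually.of_forall hint)
  · exact ge_of_tendsto (hx t) ((hev t).mono fun n hn => hlow n t hn)
  · exact le_of_tendsto (hx t) ((hev t).mono fun n hn =>
      hupp M t hXM (fun s _ => hM s) n t le_rfl hn)
  · exact le_of_tendsto (hx t) ((hev t).mono fun n hn => hupp y T hy hT n t ht hn)

end ScalarODE

section CubicODE

open Set
open scoped NNReal Topology

/-- Truncating the cubic at `±R` makes it globally Lipschitz. -/
lemma lipschitzWith_cubic_clamp (R : ℝ≥0) :
    LipschitzWith (3 + 3 * R ^ 2)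
      (fun x : ℝ => 3 * max (-R : ℝ) (min x R) - max (-R : ℝ) (min x R) ^ 3) := by
  have hclamp : LipschitzWith 1 (fun x : ℝ => max (-R : ℝ) (min x R)) :=
    (LipschitzWith.id.min_const _).const_max _
  refine LipschitzWith.of_dist_le_mul fun x y => ?_
  have h := hclamp.dist_le_mul x y
  have hbd : ∀ x : ℝ, |max (-R : ℝ) (min x R)| ≤ R := fun x =>
    abs_le.2 ⟨le_max_left _ _, max_le (neg_le_self R.2) (min_le_right _ _)⟩
  have ha := abs_le.1 (hbd x)
  have hb := abs_le.1 (hbd y)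
  generalize max (-R : ℝ) (min x R) = a at *
  generalize max (-R : ℝ) (min y R) = b at *
  have hR : (0 : ℝ) ≤ R := R.2
  rw [Real.dist_eq] at h ⊢
  have hfac : 3 * a - a ^ 3 - (3 * b - b ^ 3) = (3 - (a ^ 2 + a * b + b ^ 2)) * (a - b) := by ring
  have h1 : |3 - (a ^ 2 + a * b + b ^ 2)| ≤ 3 + 3 * (R : ℝ) ^ 2 := by
    have h2 : a ^ 2 ≤ (R : ℝ) ^ 2 := sq_le_sq' ha.1 ha.2
    have h3 : b ^ 2 ≤ (R : ℝ) ^ 2 := sq_le_sq' hb.1 hb.2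
    rw [abs_le]
    constructor <;> nlinarith [sq_nonneg (a - b), sq_nonneg (a + b)]
  rw [hfac, abs_mul]
  push_cast
  simp only [NNReal.coe_one, one_mul] at h
  gcongr

lemma exists_pullback_solution {g : ℝ → ℝ} (hg : Continuous g) {lamm lamp : ℝ}
    (hlow : ∀ t, lamm ≤ g t) (hupp : ∀ t, g t ≤ lamp) (hlim : Tendsto g atBot (𝓝 lamm))
    {X : ℝ} (hX : X < -1) (hroot : 3 * X - X ^ 3 + lamm = 0) :
    ∃ x : ℝ → ℝ, (∀ t, HasDerivAt x (3 * x t - x t ^ 3 + g t) t) ∧ Tendsto x atBot (𝓝 X) := by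
  obtain ⟨R, hR⟩ : ∃ R : ℝ≥0, (R : ℝ) = 2 + |lamp| + |X| := ⟨⟨2 + |lamp| + |X|, by positivity⟩, rfl⟩
  have hR2 : (2 : ℝ) ≤ R := by linarith [abs_nonneg lamp, abs_nonneg X]
  have hRl : lamp ≤ R := by linarith [abs_nonneg X, le_abs_self lamp]
  have hRX : -(R : ℝ) ≤ X := by linarith [abs_nonneg lamp, neg_abs_le X]
  set φ : ℝ → ℝ := fun x => 3 * max (-R : ℝ) (min x R) - max (-R : ℝ) (min x R) ^ 3
  have hφ : ∀ x, -(R : ℝ) ≤ x → x ≤ R → φ x = 3 * x - x ^ 3 := fun x h1 h2 => by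
    simp only [φ, min_eq_left h2, max_eq_right h1]
  obtain ⟨L, hL⟩ : ∃ L : ℝ≥0, ∀ x t, |φ x + g t| ≤ L := by
    refine ⟨⟨3 * R + R ^ 3 + (|lamm| + |lamp|), by positivity⟩, fun x t => ?_⟩
    have hc : |max (-R : ℝ) (min x R)| ≤ R :=
      abs_le.2 ⟨le_max_left _ _, max_le (neg_le_self R.2) (min_le_right _ _)⟩
    have h3 : |max (-R : ℝ) (min x R) ^ 3| ≤ (R : ℝ) ^ 3 := by
      rw [abs_pow]; gcongr
    change |φ x + g t| ≤ 3 * (R : ℝ) + (R : ℝ) ^ 3 + (|lamm| + |lamp|)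
    rw [abs_le] at hc h3 ⊢
    simp only [φ]
    constructor <;> linarith [hlow t, hupp t, neg_abs_le lamm, le_abs_self lamp,
      abs_nonneg lamm, abs_nonneg lamp]
  obtain ⟨x, hx, hXx, hxR, hsup⟩ := exists_complete_solution (M := R) (X := X)
    (lipschitzWith_cubic_clamp R) hg hL (by linarith)
    (fun t => by
      have : φ X = _ := hφ X hRX (by linarith)
      change 0 ≤ φ X + g t
      rw [this]; linarith [hlow t])
    (fun t => by
      have : φ R = _ := hφ R (by linarith) le_rfl
      change φ R + g t ≤ 0
      rw [this]
      nlinarith [hupp t, mul_nonneg (sub_nonneg.2 hR2) (sub_nonneg.2 hR2),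
        mul_nonneg (mul_nonneg (sub_nonneg.2 hR2) (sub_nonneg.2 hR2)) (sub_nonneg.2 hR2)])
  refine ⟨x, fun t => ?_, ?_⟩
  · rw [← hφ (x t) (hRX.trans (hXx t)) (hxR t)]
    exact hx t
  · refine tendsto_order.2 ⟨fun y hy => Eventually.of_forall fun t => hy.trans_le (hXx t),
      fun y hy => ?_⟩
    obtain ⟨z, hz, hzy⟩ := exists_between (lt_min hy hX)
    have hz1 : z < -1 := hzy.trans_le (min_le_right _ _)
    have hneg : lamm < -(3 * z - z ^ 3) := by
      have h3 : 0 < z ^ 2 + z * X + X ^ 2 - 3 := by nlinarith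
      nlinarith [mul_pos (sub_pos.2 hz) h3]
    obtain ⟨T, hT⟩ := eventually_atBot.1 (hlim.eventually (gt_mem_nhds hneg))
    filter_upwards [eventually_le_atBot T] with t ht
    refine (hsup z T hz.le (fun s hs => ?_) t ht).trans_lt (hzy.trans_le (min_le_left _ _))
    have : φ z = _ := hφ z (hRX.trans hz.le) (by linarith)
    change φ z + g s ≤ 0
    rw [this]; linarith [hT s hs]

lemma eq_of_pullback_solutions {g x y : ℝ → ℝ} {X : ℝ} (hX : X < -1)
    (hx : ∀ t, HasDerivAt x (3 * x t - x t ^ 3 + g t) t) (hxl : Tendsto x atBot (𝓝 X))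
    (hy : ∀ t, HasDerivAt y (3 * y t - y t ^ 3 + g t) t) (hyl : Tendsto y atBot (𝓝 X)) :
    x = y := by
  have hd : ∀ t, HasDerivAt (fun t => (x t - y t) ^ 2)
      (2 * (x t - y t) ^ 2 * (3 - (x t ^ 2 + x t * y t + y t ^ 2))) t := fun t =>
    (((hx t).sub (hy t)).pow 2).congr_deriv (by simp; ring)
  have hdc : Continuous fun t => (x t - y t) ^ 2 :=
    continuous_iff_continuousAt.2 fun t => (hd t).continuousAt
  obtain ⟨T, hT⟩ := eventually_atBot.1
    ((hxl.eventually (gt_mem_nhds hX)).and (hyl.eventually (gt_mem_nhds hX)))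
  have hlim : Tendsto (fun t => (x t - y t) ^ 2) atBot (𝓝 0) := by
    simpa using (hxl.sub hyl).pow 2
  have hanti : AntitoneOn (fun t => (x t - y t) ^ 2) (Iic T) := by
    refine antitoneOn_of_hasDerivWithinAt_nonpos (convex_Iic T) hdc.continuousOn
      (fun t _ => (hd t).hasDerivWithinAt) fun t ht => ?_
    obtain ⟨h1, h2⟩ := hT t (show t ∈ Iic T from interior_subset ht)
    have : 3 - (x t ^ 2 + x t * y t + y t ^ 2) ≤ 0 := by nlinarith
    exact mul_nonpos_of_nonneg_of_nonpos (by positivity) this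
  have hpast : ∀ t ≤ T, (x t - y t) ^ 2 ≤ 0 := fun t ht => by
    refine ge_of_tendsto hlim ?_
    filter_upwards [eventually_le_atBot t] with s hs
    exact hanti (hs.trans ht) ht hs
  funext t
  have : (x t - y t) ^ 2 ≤ 0 := by
    rcases le_total t T with ht | ht
    · exact hpast t ht
    · refine nonpos_of_deriv_right_le_mul (K := 6) hdc.continuousOn
        (fun s _ => (hd s).hasDerivWithinAt) (hpast T le_rfl) (fun s _ _ => ?_) t
        (right_mem_Icc.2 ht)
      have h : 0 ≤ x s ^ 2 + x s * y s + y s ^ 2 := by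
        nlinarith [sq_nonneg (x s + y s), sq_nonneg (x s), sq_nonneg (y s)]
      nlinarith [mul_nonneg (sq_nonneg (x s - y s)) h]
  exact sub_eq_zero.1 (pow_eq_zero_iff two_ne_zero |>.1 (le_antisymm this (sq_nonneg _)))

lemma tendsto_tanh_atBot : Tendsto Real.tanh atBot (𝓝 (-1)) := by
  have hexp : Tendsto (fun x : ℝ => 2 * Real.exp (x + x) - 1) atBot (𝓝 (-1)) := by
    simpa using ((Real.tendsto_exp_atBot.comp
      (tendsto_id.atBot_add_atBot tendsto_id)).const_mul 2).sub_const 1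
  refine tendsto_of_tendsto_of_tendsto_of_le_of_le tendsto_const_nhds hexp
    (fun x => (Real.neg_one_lt_tanh x).le) fun x => ?_
  have h1 : Real.exp x * Real.exp (-x) = 1 := by rw [← Real.exp_add]; simp
  have h2 := Real.exp_pos x
  have h3 := Real.exp_pos (-x)
  simp only
  rw [Real.tanh_eq, div_le_iff₀ (by positivity), Real.exp_add]
  nlinarith [mul_pos h2 (mul_pos h2 h2)]

lemma continuous_real_tanh : Continuous Real.tanh := by
  have : Real.tanh = fun x => Real.sinh x / Real.cosh x := funext Real.tanh_eq_sinh_div_cosh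
  rw [this]
  exact Real.continuous_sinh.div Real.continuous_cosh fun x => (Real.cosh_pos x).ne'

end CubicODE

/-- For the non-autonomous upstream system `x′ = 3x − x³ + Λ(rt)` with parameter shift
`Λ(s) = λ₋ + (λ₊ − λ₋)(tanh s + 1)/2`, there exists exactly one differentiable trajectory
limiting in the past to the lower stable equilibrium `X_l(λ₋)` (the pullback attractor). -/
theorem stmt_11 (lamm lamp : ℝ) (hlt : lamm < lamp) (h2 : lamm < 2) (r : ℝ) (hr : 0 < r)
    (Xlm : ℝ) (hXlm : Xlm < -1) (hXlmroot : 3 * Xlm - Xlm ^ 3 + lamm = 0) :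
    ∃! x : ℝ → ℝ,
      (∀ t : ℝ, HasDerivAt x
        (3 * x t - (x t) ^ 3 + (lamm + (lamp - lamm) * (Real.tanh (r * t) + 1) / 2)) t) ∧
      Tendsto x atBot (nhds Xlm) := by
  have hcont : Continuous fun t => lamm + (lamp - lamm) * (Real.tanh (r * t) + 1) / 2 := by
    have := continuous_real_tanh
    fun_prop
  have hlim : Tendsto (fun t => lamm + (lamp - lamm) * (Real.tanh (r * t) + 1) / 2) atBot
      (nhds lamm) := by
    simpa using ((((tendsto_tanh_atBot.comp (tendsto_id.const_mul_atBot hr)).add_const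
      1).const_mul (lamp - lamm)).div_const 2).const_add lamm
  obtain ⟨x, hx, hxl⟩ := exists_pullback_solution hcont (lamp := lamp)
    (fun t => by nlinarith [Real.neg_one_lt_tanh (r * t)])
    (fun t => by nlinarith [Real.tanh_lt_one (r * t)]) hlim hXlm hXlmroot
  exact ⟨x, ⟨hx, hxl⟩, fun y hy => eq_of_pullback_solutions hXlm hy.1 hy.2 hx hxl⟩
end

section
/- Let λ₋ < λ₊ < 2, let r > 0, define Λ(s) = λ₋ + (λ₊ − λ₋)(tanh(s) + 1)/2, and for λ < 2 let X_l(λ) denote the unique real root of 3x − x³ + λ = 0 with x < −1. If x : ℝ → ℝ is differentiable with x′(t) = 3x(t) − x(t)³ + Λ(rt) for all t and x(t) → X_l(λ₋) as t → −∞, then x(t) < −1 for all t and x(t) → X_l(λ₊) as t → +∞ (end-point tracking), for every r > 0. -/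
open Filter

lemma tendsto_tanh_atTop_one : Tendsto Real.tanh atTop (nhds 1) := by
  have hexp : Tendsto (fun y : ℝ => 1 - Real.exp (-y)) atTop (nhds 1) := by
    simpa using (Real.tendsto_exp_neg_atTop_nhds_zero).const_sub 1
  refine tendsto_of_tendsto_of_tendsto_of_le_of_le hexp tendsto_const_nhds (fun y => ?_)
    (fun y => (Real.tanh_lt_one y).le)
  have hpos := Real.cosh_pos y
  have hone := Real.one_le_cosh y
  rw [Real.tanh_eq_sinh_div_cosh, le_div_iff₀ hpos]
  have hsub := Real.cosh_sub_sinh y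
  nlinarith [Real.exp_pos (-y)]

lemma strictAntiOn_three_mul_sub_cube :
    StrictAntiOn (fun u : ℝ => 3 * u - u ^ 3) (Set.Iic (-1)) := by
  intro u _ v hv huv
  have hv' : v ≤ -1 := hv
  have hfac : 3 < u ^ 2 + u * v + v ^ 2 := by nlinarith
  show 3 * v - v ^ 3 < 3 * u - u ^ 3
  nlinarith [mul_pos (sub_pos.2 huv) (sub_pos.2 hfac)]

/-- A differentiable function whose derivative is negative wherever it takes the value `c`
cannot cross the level `c` upwards. -/
lemma le_of_hasDerivAt_neg_of_eq {f f' : ℝ → ℝ} {a c : ℝ}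
    (hf : ∀ t, HasDerivAt f (f' t) t) (ha : f a ≤ c) (hc : ∀ t, a ≤ t → f t = c → f' t < 0)
    {t : ℝ} (hat : a ≤ t) : f t ≤ c :=
  image_le_of_deriv_right_lt_deriv_boundary (a := a) (b := t) (B := fun _ => c) (B' := fun _ => 0)
    (fun s _ => (hf s).continuousAt.continuousWithinAt) (fun s _ => (hf s).hasDerivWithinAt) ha
    (fun s => hasDerivAt_const s c) (fun s hs => hc s hs.1) (Set.right_mem_Icc.2 hat)

/-- A differentiable function whose derivative is eventually bounded below by some `δ > 0`
wherever its value is at most `c` eventually stays above `c`. -/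
lemma eventually_ge_of_hasDerivAt_ge {f f' : ℝ → ℝ} {c δ : ℝ} (hδ : 0 < δ)
    (hf : ∀ t, HasDerivAt f (f' t) t) (hc : ∀ᶠ t in atTop, f t ≤ c → δ ≤ f' t) :
    ∀ᶠ t in atTop, c ≤ f t := by
  obtain ⟨T, hT⟩ := eventually_atTop.1 hc
  obtain ⟨t₀, ht₀, hft₀⟩ : ∃ t₀, T ≤ t₀ ∧ c ≤ f t₀ := by
    by_contra! hlow
    have hgrow := (convex_Ici T).mul_sub_le_image_sub_of_le_deriv (f := f) (C := δ)
      (fun s _ => (hf s).continuousAt.continuousWithinAt)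
      (fun s _ => (hf s).differentiableAt.differentiableWithinAt)
      (fun s hs => by
        have hs' : T ≤ s := interior_subset hs
        rw [(hf s).deriv]
        exact hT s hs' (hlow s hs').le)
    have hpos : 0 ≤ (c - f T) / δ := div_nonneg (sub_nonneg.2 (hlow T le_rfl).le) hδ.le
    have hle : T ≤ T + (c - f T) / δ := by linarith
    have hend := hgrow T Set.self_mem_Ici _ hle hle
    rw [add_sub_cancel_left, mul_div_cancel₀ _ hδ.ne'] at hend
    linarith [hlow _ hle]
  filter_upwards [eventually_ge_atTop t₀] with t ht
  refine neg_le_neg_iff.1 (le_of_hasDerivAt_neg_of_eq (f := fun s => -f s)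
    (fun s => (hf s).neg) (neg_le_neg hft₀) (fun s hs heq => ?_) ht)
  linarith [hT s (ht₀.trans hs) (neg_injective heq).le]

/-- Upstream end-point tracking: for `λ₋ < λ₊ < 2` and any rate `r > 0`, the pullback
trajectory of `x′ = 3x − x³ + Λ(rt)` limiting to `X_l(λ₋)` in the past stays below `−1`
and converges to `X_l(λ₊)` in the future. -/
theorem stmt_12 (lamm lamp : ℝ) (hlt : lamm < lamp) (h2 : lamp < 2) (r : ℝ) (hr : 0 < r)
    (Xl : ℝ → ℝ)
    (hXl : ∀ lam : ℝ, lam < 2 → Xl lam < -1 ∧ 3 * Xl lam - (Xl lam) ^ 3 + lam = 0)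
    (x : ℝ → ℝ)
    (hode : ∀ t : ℝ, HasDerivAt x
      (3 * x t - (x t) ^ 3 + (lamm + (lamp - lamm) * (Real.tanh (r * t) + 1) / 2)) t)
    (hpast : Tendsto x atBot (nhds (Xl lamm))) :
    (∀ t : ℝ, x t < -1) ∧ Tendsto x atTop (nhds (Xl lamp)) := by
  obtain ⟨hm, hm0⟩ := hXl lamm (hlt.trans h2)
  obtain ⟨hp, hp0⟩ := hXl lamp h2
  have hmp : Xl lamm < Xl lamp :=
    (strictAntiOn_three_mul_sub_cube.lt_iff_gt hp.le hm.le).1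
      (show 3 * Xl lamp - Xl lamp ^ 3 < 3 * Xl lamm - Xl lamm ^ 3 by linarith)
  have hΛlt : ∀ t, lamm + (lamp - lamm) * (Real.tanh (r * t) + 1) / 2 < lamp := fun t => by
    nlinarith [mul_pos (sub_pos.2 hlt) (sub_pos.2 (Real.tanh_lt_one (r * t)))]
  have hΛ : Tendsto (fun t => lamm + (lamp - lamm) * (Real.tanh (r * t) + 1) / 2) atTop
      (nhds lamp) := by
    have htanh : Tendsto (fun t => Real.tanh (r * t)) atTop (nhds 1) :=
      tendsto_tanh_atTop_one.comp (tendsto_id.const_mul_atTop hr)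
    convert (((htanh.add_const 1).const_mul (lamp - lamm)).div_const 2).const_add lamm using 2
    ring
  have hupper : ∀ t, x t ≤ Xl lamp := by
    intro t
    obtain ⟨a, hxa, hat⟩ :=
      ((hpast.eventually_lt_const hmp).and (eventually_le_atBot t)).exists
    refine le_of_hasDerivAt_neg_of_eq hode hxa.le (fun s _ hs => ?_) hat
    rw [hs]
    linarith [hΛlt s]
  refine ⟨fun t => (hupper t).trans_lt hp, tendsto_order.2 ⟨fun b hb => ?_, fun b hb =>
    Eventually.of_forall fun t => (hupper t).trans_lt hb⟩⟩
  obtain ⟨c, hbc, hc⟩ := exists_between hb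
  have hcp : 3 * Xl lamp - Xl lamp ^ 3 < 3 * c - c ^ 3 :=
    strictAntiOn_three_mul_sub_cube (hc.trans hp).le hp.le hc
  have hδ : 0 < (3 * c - c ^ 3 + lamp) / 2 := by linarith
  have hge := eventually_ge_of_hasDerivAt_ge (c := c) hδ hode (by
    filter_upwards [hΛ.eventually_const_lt (sub_lt_self lamp hδ)] with t ht hxc
    have hxc' : 3 * c - c ^ 3 ≤ 3 * x t - x t ^ 3 :=
      strictAntiOn_three_mul_sub_cube.antitoneOn ((hupper t).trans hp.le) (hc.trans hp).le hxc
    linarith)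
  exact hge.mono fun t ht => hbc.trans_le ht
end

section
/- Let λ₋ < λ₊ with λ₋ < 2, let r > 0, define Λ(s) = λ₋ + (λ₊ − λ₋)(tanh(s) + 1)/2, and let X_l(λ₋) denote the unique real root of 3x − x³ + λ₋ = 0 with x < −1. If x : ℝ → ℝ is differentiable with x′(t) = 3x(t) − x(t)³ + Λ(rt) for all t and x(t) → X_l(λ₋) as t → −∞, then x is strictly increasing on ℝ; consequently, for any real a and b > 0 the effective downstream forcing t ↦ a + b(x(t) − X_l(λ₋)) is strictly increasing. -/
open Filter

theorem tanh_strictMono : StrictMono Real.tanh := fun p q hpq => by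
  rwa [← Real.artanh_lt_artanh_iff ⟨Real.neg_one_lt_tanh p, Real.tanh_lt_one p⟩
    ⟨Real.neg_one_lt_tanh q, Real.tanh_lt_one q⟩, Real.artanh_tanh, Real.artanh_tanh]

/-- A solution of a scalar linear equation with positive forcing that vanishes in the limit
`t → -∞`, where the homogeneous part is non-expanding, is positive. -/
theorem pos_of_hasDerivAt_linear_of_tendsto_zero {c d g : ℝ → ℝ} (hc : Continuous c)
    (hd : ∀ t, HasDerivAt d (c t * d t + g t) t) (hg : ∀ t, 0 < g t)
    (hneg : ∀ᶠ t in atBot, c t ≤ 0) (hlim : Tendsto d atBot (nhds 0)) (t : ℝ) : 0 < d t := by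
  set A : ℝ → ℝ := fun t => ∫ s in (0 : ℝ)..t, c s
  have hA (t : ℝ) : HasDerivAt A (c t) t := hc.integral_hasStrictDerivAt 0 t |>.hasDerivAt
  set w : ℝ → ℝ := fun t => Real.exp (-A t) * d t
  have hw (t : ℝ) : HasDerivAt w (Real.exp (-A t) * g t) t := by
    refine ((hA t).neg.exp.mul (hd t)).congr_deriv ?_
    simp only [Pi.neg_apply]
    ring
  have hmono : StrictMono w := strictMono_of_hasDerivAt_pos hw fun t =>
    mul_pos (Real.exp_pos _) (hg t)
  have hw0 : Tendsto w atBot (nhds 0) := by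
    obtain ⟨T, hT⟩ := eventually_atBot.1 hneg
    have hanti : AntitoneOn A (Set.Iic T) := by
      refine antitoneOn_of_deriv_nonpos (convex_Iic T)
        (fun t _ => (hA t).continuousAt.continuousWithinAt)
        (fun t _ => (hA t).differentiableAt.differentiableWithinAt) fun t ht => ?_
      rw [(hA t).deriv]
      exact hT t (Set.mem_Iic.1 (interior_subset ht))
    refine squeeze_zero_norm' (a := fun t => Real.exp (-A T) * |d t|) ?_ ?_
    · filter_upwards [eventually_le_atBot T] with t ht
      rw [Real.norm_eq_abs, abs_mul, Real.abs_exp]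
      have := hanti (Set.mem_Iic.2 ht) Set.self_mem_Iic ht
      gcongr
    · simpa using hlim.abs.const_mul (Real.exp (-A T))
  have h0 : 0 ≤ w (t - 1) := 
    le_of_tendsto hw0 ((eventually_le_atBot (t - 1)).mono fun s hs => hmono.monotone hs)
  have : 0 < w t := h0.trans_lt (hmono (by linarith))
  exact pos_of_mul_pos_right this (Real.exp_pos _).le

/-- The pullback trajectory of the upstream system is strictly increasing; hence the
linearly coupled effective downstream forcing `t ↦ a + b(x(t) − X_l(λ₋))` is strictly
increasing for any `a` and `b > 0`. -/
theorem stmt_14 (lamm lamp : ℝ) (hlt : lamm < lamp) (h2 : lamm < 2) (r : ℝ) (hr : 0 < r)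
    (Xlm : ℝ) (hXlm : Xlm < -1) (hXlmroot : 3 * Xlm - Xlm ^ 3 + lamm = 0)
    (x : ℝ → ℝ)
    (hode : ∀ t : ℝ, HasDerivAt x
      (3 * x t - (x t) ^ 3 + (lamm + (lamp - lamm) * (Real.tanh (r * t) + 1) / 2)) t)
    (hpast : Tendsto x atBot (nhds Xlm)) :
    StrictMono x ∧
    ∀ a b : ℝ, 0 < b → StrictMono (fun t : ℝ => a + b * (x t - Xlm)) := by
  have hmono : StrictMono x := by
    intro p q hpq
    set h := q - p with hh
    have hpos : 0 < h := sub_pos.2 hpq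
    have hcont : Continuous x := continuous_iff_continuousAt.2 fun t => (hode t).continuousAt
    have hshift : Tendsto (fun t => x (t + h)) atBot (nhds Xlm) :=
      hpast.comp (tendsto_atBot_add_const_right _ h tendsto_id)
    have key := pos_of_hasDerivAt_linear_of_tendsto_zero
      (c := fun t => 3 - (x (t + h) ^ 2 + x (t + h) * x t + x t ^ 2))
      (d := fun t => x (t + h) - x t)
      (g := fun t => (lamp - lamm) * (Real.tanh (r * (t + h)) - Real.tanh (r * t)) / 2)
      (by fun_prop)
      (fun t => by
        refine (((hode (t + h)).comp_add_const t h).sub (hode t)).congr_deriv ?_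
        ring)
      (fun t => by
        have : Real.tanh (r * t) < Real.tanh (r * (t + h)) :=
          tanh_strictMono (by nlinarith)
        have := mul_pos (sub_pos.2 hlt) (sub_pos.2 this)
        linarith)
      (by
        filter_upwards [hpast.eventually_lt_const hXlm, hshift.eventually_lt_const hXlm]
          with t h1 h2
        nlinarith)
      (by simpa using hshift.sub hpast) p
    have hq : p + h = q := by rw [hh]; ring
    simp only [hq] at key
    linarith
  exact ⟨hmono, fun a b hb p q hpq => by
    have := mul_lt_mul_of_pos_left (hmono hpq) hb
    simp only
    linarith⟩
end

section
/- Let λ₋ < 2 < λ₊, r > 0, ε > 0, a < 2 and b > 0, define Λ(s) = λ₋ + (λ₊ − λ₋)(tanh(s) + 1)/2, let X_l(λ) (for λ < 2) denote the unique real root of 3x − x³ + λ = 0 with x < −1 and X_u(λ) (for λ > −2) the unique real root with x > 1, and set M₊ = a + b(X_u(λ₊) − X_l(λ₋)). Suppose M₊ < 2. If (x, y) : ℝ → ℝ² is differentiable with x′(t) = 3x(t) − x(t)³ + Λ(rt) and ε y′(t) = 3y(t) − y(t)³ + a + b(x(t) − X_l(λ₋)) for all t, and (x(t), y(t)) → (X_l(λ₋),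 X_l(a)) as t → −∞, then y(t) < −1 for all t and y(t) → X_l(M₊) as t → +∞ (downstream end-point tracking), for every ε > 0. -/
open Filter

/-- A differentiable function that is at most `L` at time `t₀` and decreases whenever it
equals `L` stays at most `L` after `t₀`. -/
lemma le_of_deriv_neg_at_level {u : ℝ → ℝ} (hu : Differentiable ℝ u) {L t₀ : ℝ}
    (h₀ : u t₀ ≤ L) (hL : ∀ t, t₀ ≤ t → u t = L → deriv u t < 0) {t : ℝ} (ht : t₀ ≤ t) :
    u t ≤ L :=
  image_le_of_deriv_right_lt_deriv_boundary (f := u) (f' := deriv u) (a := t₀) (b := t)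
    (B := fun _ => L) (B' := fun _ => 0) hu.continuous.continuousOn
    (fun s _ => (hu s).hasDerivAt.hasDerivWithinAt) h₀ (fun s => hasDerivAt_const s L)
    (fun s hs h => hL s hs.1 h) ⟨ht, le_rfl⟩

/-- A differentiable function whose past limit lies below `L` and that decreases whenever it
equals `L` stays strictly below `L` forever. -/
lemma lt_of_tendsto_atBot_of_deriv_neg_at_level {u : ℝ → ℝ} (hu : Differentiable ℝ u)
    {l L : ℝ} (hlim : Tendsto u atBot (nhds l)) (hl : l < L)
    (hL : ∀ t, u t = L → deriv u t < 0) (t : ℝ) : u t < L := by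
  have hle : ∀ s, u s ≤ L := fun s => by
    obtain ⟨t₀, h₀, hs⟩ := ((hlim.eventually_lt_const hl).and (eventually_le_atBot s)).exists
    exact le_of_deriv_neg_at_level hu h₀.le (fun t _ => hL t) hs
  refine (hle t).lt_of_ne fun h => (hL t h).ne ?_
  have hmax : IsLocalMax u t := Eventually.of_forall fun s => (hle s).trans h.ge
  exact hmax.deriv_eq_zero

/-- A function bounded above by `L` whose derivative is eventually bounded below by a positive
constant on each sublevel set `u ≤ L - δ` converges to `L`. -/
lemma tendsto_of_lt_of_deriv_ge {u : ℝ → ℝ} (hu : Differentiable ℝ u) {L : ℝ}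
    (hlt : ∀ t, u t < L)
    (hge : ∀ δ > 0, ∃ c > 0, ∃ T, ∀ t, T ≤ t → u t ≤ L - δ → c ≤ deriv u t) :
    Tendsto u atTop (nhds L) := by
  refine tendsto_order.2 ⟨fun l hl => ?_, fun l hl => Eventually.of_forall fun t => (hlt t).trans hl⟩
  obtain ⟨c, hc, T, hT⟩ := hge ((L - l) / 2) (by linarith)
  obtain ⟨T₁, hT₁, hu₁⟩ : ∃ T₁, T ≤ T₁ ∧ L - (L - l) / 2 ≤ u T₁ := by
    by_contra! hcon
    have hgrow := (convex_Ici T).mul_sub_le_image_sub_of_le_deriv hu.continuous.continuousOn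
      hu.differentiableOn (C := c)
      (fun t ht => by
        have ht' : T ≤ t := interior_subset ht
        exact hT t ht' (hcon t ht').le)
    have hpos : 0 < (L - u T) / c := div_pos (by linarith [hlt T]) hc
    have h := hgrow T Set.self_mem_Ici (T + (L - u T) / c) (by simpa using hpos.le) (by linarith)
    have hval : c * (T + (L - u T) / c - T) = L - u T := by field_simp; ring
    linarith [hlt (T + (L - u T) / c)]
  filter_upwards [eventually_ge_atTop T₁] with t ht
  have h : -u t ≤ -(L - (L - l) / 2) := by
    refine le_of_deriv_neg_at_level (u := fun s => -u s) hu.neg (neg_le_neg hu₁)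
      (fun s hs h => ?_) ht
    have := hT s (hT₁.trans hs) (neg_injective h).le
    rw [deriv.fun_neg]
    linarith
  linarith

/-- Asymptotically autonomous convergence from below to a root `R` of `3u - u³ + m`. -/
lemma tendsto_root_of_forced_cubic {u μ : ℝ → ℝ} (hu : Differentiable ℝ u) {ε m R K : ℝ}
    (hε : 0 < ε) (hode : ∀ t, ε * deriv u t = 3 * u t - u t ^ 3 + μ t)
    (hμ : Tendsto μ atTop (nhds m)) (hlt : ∀ t, u t < R) (hK : 0 < K)
    (hcubic : ∀ v < R, K * (R - v) ≤ 3 * v - v ^ 3 + m) : Tendsto u atTop (nhds R) := by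
  refine tendsto_of_lt_of_deriv_ge hu hlt fun δ hδ => ?_
  have hKδ : 0 < K * δ := mul_pos hK hδ
  obtain ⟨T, hT⟩ := eventually_atTop.1
    (hμ.eventually_const_lt (show m - K * δ / 2 < m by linarith))
  refine ⟨K * δ / 2 / ε, by positivity, T, fun t ht hle => ?_⟩
  rw [div_le_iff₀ hε, mul_comm _ ε, hode t]
  have h₁ := hcubic (u t) (hlt t)
  have h₂ : K * δ ≤ K * (R - u t) := mul_le_mul_of_nonneg_left (by linarith) hK.le
  linarith [hT t ht]

lemma cubic_ge_of_root_lt_neg_one {R m v : ℝ} (hR : R < -1) (hroot : 3 * R - R ^ 3 + m = 0)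
    (hv : v < R) : 3 * (R ^ 2 - 1) * (R - v) ≤ 3 * v - v ^ 3 + m := by
  have h : 0 ≤ (R - v) * ((R - v) * (-2 * R - v)) :=
    mul_nonneg (by linarith) (mul_nonneg (by linarith) (by linarith))
  linear_combination h - hroot

lemma two_lt_of_root_of_two_lt {R m : ℝ} (hm : 2 < m)
    (hroot : 3 * R - R ^ 3 + m = 0) : 2 < R := by
  by_contra! h
  nlinarith [mul_nonneg (sub_nonneg.2 h) (sq_nonneg (R + 1))]

lemma cubic_ge_of_two_lt_root {R m v : ℝ} (hroot : 3 * R - R ^ 3 + m = 0)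
    (hv : v < R) : (3 * R ^ 2 / 4 - 3) * (R - v) ≤ 3 * v - v ^ 3 + m := by
  have h : 0 ≤ (R - v) * (v + R / 2) ^ 2 := mul_nonneg (by linarith) (sq_nonneg _)
  linear_combination h - hroot

/-- Downstream end-point tracking for linear coupling: if the future limit
`M₊ = a + b(X_u(λ₊) − X_l(λ₋))` of the effective downstream forcing remains below the
fold value `2`, then for every timescale separation `ε > 0` the downstream pullback
trajectory stays below `−1` and converges to `X_l(M₊)`. -/
theorem stmt_16 (lamm lamp : ℝ) (hm : lamm < 2) (hp : 2 < lamp)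
    (r : ℝ) (hr : 0 < r) (eps : ℝ) (heps : 0 < eps)
    (a b : ℝ) (ha : a < 2) (hb : 0 < b)
    (Xlm : ℝ) (hXlm : Xlm < -1) (hXlmroot : 3 * Xlm - Xlm ^ 3 + lamm = 0)
    (Xla : ℝ) (hXla : Xla < -1) (hXlaroot : 3 * Xla - Xla ^ 3 + a = 0)
    (Xup : ℝ) (hXup : Xup > 1) (hXuproot : 3 * Xup - Xup ^ 3 + lamp = 0)
    (hMp : a + b * (Xup - Xlm) < 2)
    (XlM : ℝ) (hXlM : XlM < -1)
    (hXlMroot : 3 * XlM - XlM ^ 3 + (a + b * (Xup - Xlm)) = 0)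
    (x y : ℝ → ℝ) (hdx : Differentiable ℝ x) (hdy : Differentiable ℝ y)
    (hodex : ∀ t : ℝ, deriv x t =
      3 * x t - (x t) ^ 3 + (lamm + (lamp - lamm) * (Real.tanh (r * t) + 1) / 2))
    (hodey : ∀ t : ℝ, eps * deriv y t = 3 * y t - (y t) ^ 3 + (a + b * (x t - Xlm)))
    (hpastx : Tendsto x atBot (nhds Xlm))
    (hpasty : Tendsto y atBot (nhds Xla)) :
    (∀ t : ℝ, y t < -1) ∧ Tendsto y atTop (nhds XlM) := by
  have hmu : Tendsto (fun t => lamm + (lamp - lamm) * (Real.tanh (r * t) + 1) / 2) atTop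
      (nhds lamp) := by
    have h : Tendsto (fun t => Real.tanh (r * t)) atTop (nhds 1) :=
      tendsto_tanh_atTop_one.comp (tendsto_id.const_mul_atTop hr)
    convert (((h.add_const 1).const_mul (lamp - lamm)).div_const 2).const_add lamm using 2
    ring
  have hxlt : ∀ t, x t < Xup :=
    lt_of_tendsto_atBot_of_deriv_neg_at_level hdx hpastx (by linarith) fun t ht => by
      rw [hodex, ht]
      nlinarith [mul_pos (show 0 < lamp - lamm by linarith)
        (sub_pos.2 (Real.tanh_lt_one (r * t)))]
  have hXup2 : 2 < Xup := two_lt_of_root_of_two_lt hp hXuproot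
  have hxlim : Tendsto x atTop (nhds Xup) :=
    tendsto_root_of_forced_cubic hdx one_pos (fun t => by rw [one_mul, hodex]) hmu hxlt
      (show 0 < 3 * Xup ^ 2 / 4 - 3 by nlinarith)
      (fun v hv => cubic_ge_of_two_lt_root hXuproot hv)
  have hXla_lt : Xla < XlM := by
    by_contra! h
    have hgap : 0 < b * (Xup - Xlm) := mul_pos hb (by linarith)
    rcases h.eq_or_lt with h | h
    · subst h
      linarith
    · have h₁ := cubic_ge_of_root_lt_neg_one hXla hXlaroot h
      have h₂ : 0 < 3 * (Xla ^ 2 - 1) * (Xla - XlM) :=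
        mul_pos (by nlinarith) (by linarith)
      linarith
  have hylt : ∀ t, y t < XlM :=
    lt_of_tendsto_atBot_of_deriv_neg_at_level hdy hpasty hXla_lt fun t ht => by
      have h₁ := hodey t
      rw [ht] at h₁
      have h₂ := mul_pos hb (sub_pos.2 (hxlt t))
      refine (pos_iff_neg_of_mul_neg (?_ : eps * deriv y t < 0)).1 heps
      linarith
  refine ⟨fun t => (hylt t).trans hXlM, ?_⟩
  exact tendsto_root_of_forced_cubic hdy heps hodey
    (((hxlim.sub_const Xlm).const_mul b).const_add a) hylt
    (show 0 < 3 * (XlM ^ 2 - 1) by nlinarith)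
    (fun v hv => cubic_ge_of_root_lt_neg_one hXlM hXlMroot hv)
end
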